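/- arXiv:2601.08772 — 7 statements merged into one kernel-verified Lean document; each statement's English description precedes it below -/
import Mathlib

section
/- Let N ≥ 1, let P ∈ M_N(ℂ) be a Hermitian matrix with P² = 1, and let θ ∈ ℝ. Then for every ρ ∈ M_N(ℂ), R_P(θ) ρ R_P(θ)† = Σ_{k=0}^{3} a_k(θ) · R_P(kπ/2) ρ R_P(kπ/2)†, where a_k(θ) are the quasiprobability coefficients defined below. (This is the exact Clifford decomposition of an arbitrary Pauli rotation channel from Lemma 2.) -/
open Matrix

/-- The rotation gate `R_P(θ) = cos(θ/2)·1 − i·sin(θ/2)·P` generated by a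
Hermitian involution `P`. -/
noncomputable def rotGate {N : ℕ} (P : Matrix (Fin N) (Fin N) ℂ) (θ : ℝ) :
    Matrix (Fin N) (Fin N) ℂ :=
  (Real.cos (θ / 2) : ℂ) • (1 : Matrix (Fin N) (Fin N) ℂ) -
    (Complex.I * (Real.sin (θ / 2) : ℂ)) • P

/-- The quasiprobability coefficients `a_k(θ)` of the optimal Clifford
decomposition of a Pauli rotation. -/
noncomputable def qpCoeff (θ : ℝ) : Fin 4 → ℝ :=
  ![|Real.cos θ| / (2 * (|Real.sin θ| + |Real.cos θ|)) + Real.cos θ / 2,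
    |Real.sin θ| / (2 * (|Real.sin θ| + |Real.cos θ|)) + Real.sin θ / 2,
    |Real.cos θ| / (2 * (|Real.sin θ| + |Real.cos θ|)) - Real.cos θ / 2,
    |Real.sin θ| / (2 * (|Real.sin θ| + |Real.cos θ|)) - Real.sin θ / 2]

/-- The rotation channel is an affine function of `(cos θ, sin θ)`. -/
theorem rotGate_conj_eq {N : ℕ} {P : Matrix (Fin N) (Fin N) ℂ} (hP : P.IsHermitian)
    (θ : ℝ) (ρ : Matrix (Fin N) (Fin N) ℂ) :
    rotGate P θ * ρ * (rotGate P θ)ᴴ =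
      (1 / 2 : ℂ) • (ρ + P * ρ * P) + ((Real.cos θ : ℂ) / 2) • (ρ - P * ρ * P) +
        (Complex.I * (Real.sin θ : ℂ) / 2) • (ρ * P - P * ρ) := by
  have hadj : (rotGate P θ)ᴴ = (Real.cos (θ / 2) : ℂ) • (1 : Matrix (Fin N) (Fin N) ℂ) +
      (Complex.I * (Real.sin (θ / 2) : ℂ)) • P := by
    simp only [rotGate, conjTranspose_sub, conjTranspose_smul, conjTranspose_one, hP.eq,
      star_mul', Complex.star_def, Complex.conj_I, Complex.conj_ofReal, neg_mul, neg_smul,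
      sub_neg_eq_add]
  have hcos : (Real.cos θ : ℂ) = 2 * (Real.cos (θ / 2) : ℂ) ^ 2 - 1 := by
    have h := Real.cos_two_mul (θ / 2)
    rw [mul_div_cancel₀ θ two_ne_zero] at h
    exact_mod_cast h
  have hsin : (Real.sin θ : ℂ) = 2 * (Real.sin (θ / 2) : ℂ) * (Real.cos (θ / 2) : ℂ) := by
    have h := Real.sin_two_mul (θ / 2)
    rw [mul_div_cancel₀ θ two_ne_zero] at h
    exact_mod_cast h
  have hsq : (Real.sin (θ / 2) : ℂ) ^ 2 + (Real.cos (θ / 2) : ℂ) ^ 2 = 1 := by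
    exact_mod_cast Real.sin_sq_add_cos_sq (θ / 2)
  rw [hadj, hcos, hsin, rotGate]
  generalize (Real.cos (θ / 2) : ℂ) = c at *
  generalize (Real.sin (θ / 2) : ℂ) = s at *
  simp only [sub_mul, mul_add, smul_mul_assoc, mul_smul_comm, one_mul, mul_one]
  match_scalars
  · ring
  · ring
  · ring
  · linear_combination (-s ^ 2) * Complex.I_sq + hsq

/-- The denominator of the coefficients never vanishes. -/
theorem abs_sin_add_abs_cos_pos (θ : ℝ) : 0 < |Real.sin θ| + |Real.cos θ| := by
  rcases eq_or_ne (Real.sin θ) 0 with h | h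
  · have hc : Real.cos θ ≠ 0 := by
      intro hc
      simpa [h, hc] using Real.sin_sq_add_cos_sq θ
    positivity
  · positivity

theorem qpCoeff_sum (θ : ℝ) :
    qpCoeff θ 0 + qpCoeff θ 1 + qpCoeff θ 2 + qpCoeff θ 3 = 1 := by
  have h := (abs_sin_add_abs_cos_pos θ).ne'
  simp only [qpCoeff, cons_val]
  field_simp
  ring

/-- Exact Clifford decomposition of an arbitrary Pauli rotation channel. -/
theorem clifford_decomposition_of_rotation_channel
    (N : ℕ) (hN : 1 ≤ N) (P : Matrix (Fin N) (Fin N) ℂ)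
    (hHerm : P.IsHermitian) (hP2 : P * P = 1) (θ : ℝ)
    (ρ : Matrix (Fin N) (Fin N) ℂ) :
    rotGate P θ * ρ * (rotGate P θ)ᴴ =
      ∑ k : Fin 4, (qpCoeff θ k : ℂ) •
        (rotGate P ((k : ℕ) * Real.pi / 2) * ρ *
          (rotGate P ((k : ℕ) * Real.pi / 2))ᴴ) := by
  have hsum : (qpCoeff θ 0 + qpCoeff θ 1 + qpCoeff θ 2 + qpCoeff θ 3 : ℂ) = 1 := by
    exact_mod_cast qpCoeff_sum θ
  have hcos : (Real.cos θ : ℂ) = qpCoeff θ 0 - qpCoeff θ 2 := by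
    rw [← Complex.ofReal_sub]
    congr 1
    simp only [qpCoeff, cons_val]
    ring
  have hsin : (Real.sin θ : ℂ) = qpCoeff θ 1 - qpCoeff θ 3 := by
    rw [← Complex.ofReal_sub]
    congr 1
    simp only [qpCoeff, cons_val]
    ring
  have htwo : (2 : ℝ) * Real.pi / 2 = Real.pi := by ring
  have hthree : (3 : ℝ) * Real.pi / 2 = Real.pi / 2 + Real.pi := by ring
  have hval : ((3 : Fin 4) : ℕ) = 3 := rfl
  have hval' : ((2 : Fin 4) : ℕ) = 2 := rfl
  simp only [rotGate_conj_eq hHerm, Fin.sum_univ_four, hcos, hsin, hval, hval',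
    Fin.val_zero, Fin.val_one, Nat.cast_zero, Nat.cast_one, Nat.cast_ofNat, zero_mul, zero_div,
    one_mul, htwo, hthree, Real.cos_zero, Real.sin_zero, Real.cos_pi_div_two,
    Real.sin_pi_div_two, Real.cos_pi, Real.sin_pi, Real.cos_add_pi, Real.sin_add_pi,
    Complex.ofReal_zero, Complex.ofReal_one, Complex.ofReal_neg, neg_zero]
  generalize (qpCoeff θ 0 : ℂ) = a at *
  generalize (qpCoeff θ 1 : ℂ) = b at *
  generalize (qpCoeff θ 2 : ℂ) = c at *
  generalize (qpCoeff θ 3 : ℂ) = d at *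
  match_scalars
  · linear_combination (-1 / 2 : ℂ) * hsum
  · linear_combination (-1 / 2 : ℂ) * hsum
  · ring
  · ring
end

section
/- For every θ ∈ ℝ, the ℓ1-norm of the quasiprobability coefficients of the optimal Clifford decomposition of a Pauli rotation satisfies Σ_{k=0}^{3} |a_k(θ)| = |sin θ| + |cos θ|. -/
theorem abs_add_add_abs_sub_of_abs_le {p c : ℝ} (h : |p| ≤ |c|) :
    |p + c| + |p - c| = 2 * |c| := by
  grind

theorem one_le_abs_sin_add_abs_cos (θ : ℝ) : 1 ≤ |Real.sin θ| + |Real.cos θ| := by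
  nlinarith [Real.sin_sq_add_cos_sq θ, sq_abs (Real.sin θ), sq_abs (Real.cos θ),
    abs_nonneg (Real.sin θ), abs_nonneg (Real.cos θ)]

theorem abs_abs_div_two_mul_le {S : ℝ} (hS : 1 ≤ S) (c : ℝ) :
    |(|c| / (2 * S))| ≤ |c / 2| := by
  rw [abs_div, abs_abs, abs_div, abs_of_pos (by linarith : 0 < 2 * S), abs_two]
  gcongr
  linarith

/-- The ℓ1-norm of the quasiprobability coefficients of the optimal Clifford
decomposition of a Pauli rotation equals `|sin θ| + |cos θ|`. -/
theorem l1_norm_of_qpCoeff (θ : ℝ) :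
    ∑ k : Fin 4, |qpCoeff θ k| = |Real.sin θ| + |Real.cos θ| := by
  have hS := one_le_abs_sin_add_abs_cos θ
  have hc := abs_add_add_abs_sub_of_abs_le (abs_abs_div_two_mul_le hS (Real.cos θ))
  have hs := abs_add_add_abs_sub_of_abs_le (abs_abs_div_two_mul_le hS (Real.sin θ))
  rw [abs_div _ 2, abs_two] at hc hs
  simp only [qpCoeff, Fin.sum_univ_four, Matrix.cons_val]
  linarith
end

section
/- Let N ≥ 1, let P ∈ M_N(ℂ) be Hermitian with P² = 1, and let θ, γ ∈ ℝ. Then the noisy rotation channel decomposes into the four Clifford-angle rotation channels: for every ρ ∈ M_N(ℂ), (1−γ)·R_P(θ) ρ R_P(θ)† + γ·P (R_P(θ) ρ R_P(θ)†) P = Σ_{k=0}^{3} a_k(θ,γ) · R_P(kπ/2) ρ R_P(kπ/2)†, where a_k(θ,γ) are the noisy quasiprobability coefficients defined below. -/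
open Matrix

/-- The noisy quasiprobability coefficients `a_k(θ,γ)`. -/
noncomputable def qpCoeffNoisy (θ γ : ℝ) : Fin 4 → ℝ :=
  ![|Real.cos θ| / (2 * (|Real.sin θ| + |Real.cos θ|)) + (1 - 2 * γ) * Real.cos θ / 2,
    |Real.sin θ| / (2 * (|Real.sin θ| + |Real.cos θ|)) + (1 - 2 * γ) * Real.sin θ / 2,
    |Real.cos θ| / (2 * (|Real.sin θ| + |Real.cos θ|)) - (1 - 2 * γ) * Real.cos θ / 2,
    |Real.sin θ| / (2 * (|Real.sin θ| + |Real.cos θ|)) - (1 - 2 * γ) * Real.sin θ / 2]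

/-- Conjugation by `R_P(θ)` in terms of the maps `ρ ↦ ρ`, `ρ ↦ PρP` and `ρ ↦ i(ρP − Pρ)`. -/
theorem rotGate_conj {N : ℕ} {P : Matrix (Fin N) (Fin N) ℂ} (hP : P.IsHermitian) (θ : ℝ)
    (ρ : Matrix (Fin N) (Fin N) ℂ) :
    rotGate P θ * ρ * (rotGate P θ)ᴴ =
      (((1 + Real.cos θ) / 2 : ℝ) : ℂ) • ρ + (((1 - Real.cos θ) / 2 : ℝ) : ℂ) • (P * ρ * P) +
        ((Real.sin θ / 2 : ℝ) : ℂ) • (Complex.I • (ρ * P - P * ρ)) := by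
  have hcos : Real.cos θ = 2 * Real.cos (θ / 2) ^ 2 - 1 := by
    rw [← Real.cos_two_mul]; ring_nf
  have hsin : Real.sin θ = 2 * Real.sin (θ / 2) * Real.cos (θ / 2) := by
    rw [← Real.sin_two_mul]; ring_nf
  have h1 : (1 + Real.cos θ) / 2 = Real.cos (θ / 2) ^ 2 := by linarith
  have h2 : (1 - Real.cos θ) / 2 = Real.sin (θ / 2) ^ 2 := by
    linarith [Real.sin_sq_add_cos_sq (θ / 2)]
  have h3 : Real.sin θ / 2 = Real.sin (θ / 2) * Real.cos (θ / 2) := by linarith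
  have hadj : (rotGate P θ)ᴴ = (Real.cos (θ / 2) : ℂ) • (1 : Matrix (Fin N) (Fin N) ℂ) +
      (Complex.I * (Real.sin (θ / 2) : ℂ)) • P := by
    simp only [rotGate, conjTranspose_sub, conjTranspose_smul, conjTranspose_one, hP.eq,
      Complex.star_def, map_mul, Complex.conj_I, Complex.conj_ofReal]
    module
  rw [h1, h2, h3, hadj, rotGate]
  generalize Real.cos (θ / 2) = c
  generalize Real.sin (θ / 2) = s
  simp only [sub_mul, mul_add, smul_mul_assoc, mul_smul_comm, one_mul, mul_one]
  push_cast
  match_scalars <;> first | ring1 | linear_combination (-(s : ℂ) ^ 2) * Complex.I_sq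

/-- Conjugation by `P` after `R_P(θ)` reverses the signs of `cos θ` and `sin θ`. -/
theorem conj_rotGate_conj {N : ℕ} {P : Matrix (Fin N) (Fin N) ℂ} (hP : P.IsHermitian)
    (hP2 : P * P = 1) (θ : ℝ) (ρ : Matrix (Fin N) (Fin N) ℂ) :
    P * (rotGate P θ * ρ * (rotGate P θ)ᴴ) * P =
      (((1 - Real.cos θ) / 2 : ℝ) : ℂ) • ρ + (((1 + Real.cos θ) / 2 : ℝ) : ℂ) • (P * ρ * P) -
        ((Real.sin θ / 2 : ℝ) : ℂ) • (Complex.I • (ρ * P - P * ρ)) := by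
  have hleft : ∀ M : Matrix (Fin N) (Fin N) ℂ, P * (P * M) = M := fun M => by
    rw [← mul_assoc, hP2, one_mul]
  rw [rotGate_conj hP]
  simp only [mul_add, add_mul, mul_sub, sub_mul, smul_mul_assoc, mul_smul_comm, mul_assoc, hP2,
    hleft, mul_one]
  module

/-- The axis-aligned noisy rotation channel decomposes into the four
Clifford-angle rotation channels with coefficients `a_k(θ,γ)`. -/
theorem noisy_rotation_clifford_decomposition
    (N : ℕ) (hN : 1 ≤ N) (P : Matrix (Fin N) (Fin N) ℂ)
    (hHerm : P.IsHermitian) (hP2 : P * P = 1) (θ γ : ℝ)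
    (ρ : Matrix (Fin N) (Fin N) ℂ) :
    ((1 - γ : ℝ) : ℂ) • (rotGate P θ * ρ * (rotGate P θ)ᴴ) +
        (γ : ℂ) • (P * (rotGate P θ * ρ * (rotGate P θ)ᴴ) * P) =
      ∑ k : Fin 4, (qpCoeffNoisy θ γ k : ℂ) •
        (rotGate P ((k : ℕ) * Real.pi / 2) * ρ *
          (rotGate P ((k : ℕ) * Real.pi / 2))ᴴ) := by
  have hsum : |Real.cos θ| / (2 * (|Real.sin θ| + |Real.cos θ|)) +
      |Real.sin θ| / (2 * (|Real.sin θ| + |Real.cos θ|)) = 1 / 2 := by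
    have := (abs_sin_add_abs_cos_pos θ).ne'
    field_simp
    ring
  have hcos3 : Real.cos (3 * Real.pi / 2) = 0 := by
    rw [show 3 * Real.pi / 2 = Real.pi / 2 + Real.pi by ring, Real.cos_add_pi, Real.cos_pi_div_two,
      neg_zero]
  have hsin3 : Real.sin (3 * Real.pi / 2) = -1 := by
    rw [show 3 * Real.pi / 2 = Real.pi / 2 + Real.pi by ring, Real.sin_add_pi, Real.sin_pi_div_two]
  have hangle2 : 2 * Real.pi / 2 = Real.pi := by ring
  rw [conj_rotGate_conj hHerm hP2]
  simp only [rotGate_conj hHerm, Fin.sum_univ_four, qpCoeffNoisy, Fin.val_zero, Fin.val_one,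
    Fin.val_two, show ((3 : Fin 4) : ℕ) = 3 from rfl, Nat.cast_zero, Nat.cast_one, Nat.cast_ofNat,
    zero_mul, zero_div, one_mul, hangle2, hcos3, hsin3, Real.cos_zero, Real.sin_zero,
    Real.cos_pi_div_two, Real.sin_pi_div_two, Real.cos_pi, Real.sin_pi, cons_val]
  generalize |Real.cos θ| / (2 * (|Real.sin θ| + |Real.cos θ|)) = a at hsum ⊢
  obtain rfl := eq_sub_of_add_eq hsum
  push_cast
  module
end

section
/- For every θ ∈ ℝ and every γ ∈ [0, 1/2], the ℓ1-norm of the noisy quasiprobability coefficients satisfies Σ_{k=0}^{3} |a_k(θ,γ)| = max(1, (1−2γ)(|sin θ| + |cos θ|)). -/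
theorem abs_add_add_abs_sub_eq_two_mul_max (x y : ℝ) :
    |x + y| + |x - y| = 2 * max |x| |y| := by
  rcases abs_cases (x + y) with h₁ | h₁ <;> rcases abs_cases (x - y) with h₂ | h₂ <;>
    rcases abs_cases x with h₃ | h₃ <;> rcases abs_cases y with h₄ | h₄ <;>
    rcases max_cases |x| |y| with h₅ | h₅ <;> linarith

theorem abs_qp_pair {S g : ℝ} (hS : 0 < S) (hg : 0 ≤ g) (c : ℝ) :
    |(|c| / (2 * S) + g * c / 2)| + |(|c| / (2 * S) - g * c / 2)| = |c| * max (1 / S) g := by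
  have h₁ : |(|c| / (2 * S))| = |c| / 2 * (1 / S) := by
    rw [abs_of_nonneg (by positivity)]
    field_simp
  have h₂ : |g * c / 2| = |c| / 2 * g := by
    rw [abs_div, abs_mul, abs_of_nonneg hg, abs_two]
    ring
  rw [abs_add_add_abs_sub_eq_two_mul_max, h₁, h₂, ← mul_max_of_nonneg _ _ (by positivity)]
  ring

/-- The ℓ1-norm of the noisy quasiprobability coefficients equals
`max(1, (1−2γ)(|sin θ| + |cos θ|))` for `γ ∈ [0, 1/2]`. -/
theorem l1_norm_of_noisy_qpCoeff (θ γ : ℝ) (hγ : γ ∈ Set.Icc (0 : ℝ) (1 / 2)) :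
    ∑ k : Fin 4, |qpCoeffNoisy θ γ k| =
      max 1 ((1 - 2 * γ) * (|Real.sin θ| + |Real.cos θ|)) := by
  obtain ⟨-, hγ⟩ := hγ
  have hg : 0 ≤ 1 - 2 * γ := by linarith
  have hS : 0 < |Real.sin θ| + |Real.cos θ| := by
    by_contra! h
    have hs : Real.sin θ = 0 :=
      abs_eq_zero.mp (by linarith [abs_nonneg (Real.sin θ), abs_nonneg (Real.cos θ)])
    have hc : Real.cos θ = 0 :=
      abs_eq_zero.mp (by linarith [abs_nonneg (Real.sin θ), abs_nonneg (Real.cos θ)])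
    simpa [hs, hc] using Real.sin_sq_add_cos_sq θ
  have hcos := abs_qp_pair hS hg (Real.cos θ)
  have hsin := abs_qp_pair hS hg (Real.sin θ)
  have hmax : (|Real.sin θ| + |Real.cos θ|) *
      max (1 / (|Real.sin θ| + |Real.cos θ|)) (1 - 2 * γ) =
      max 1 ((1 - 2 * γ) * (|Real.sin θ| + |Real.cos θ|)) := by
    rw [mul_max_of_nonneg _ _ hS.le, mul_one_div_cancel hS.ne', mul_comm]
  rw [← hmax, add_mul, ← hcos, ← hsin, Fin.sum_univ_four]
  simp only [qpCoeffNoisy, Matrix.cons_val]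
  ring
end

section
/- (Effect of Pauli insertions, Theorem 1.) Let n, L ≥ 1 and N = 2ⁿ. For each layer l = 1,…,L let E_l be an ℂ-linear map on M_N(ℂ) that is a Pauli channel (a real linear combination of conjugations ρ ↦ WρW by n-qubit Pauli words W), which is bijective and whose inverse E_l⁻¹ is also a real linear combination of conjugations by n-qubit Pauli words. Let U_1,…,U_L ∈ M_N(ℂ) be unitaries (the target gates), let J be a finite index set, and for each j ∈ J and each layer l let V_{l,j} ∈ M_N(ℂ) be a unitary (the Clifford configurations), with real coefficients b_j for j ∈ J. Fix O, ρ ∈ M_N(ℂ). Suppose that for every tuple (Q_1,…,Q_L) of n-qubit Pauli words, Tr[O · (Conj_{Q_L} ∘ E_L ∘ Conj_{U_L} ∘ ⋯ ∘ Conj_{Q_1} ∘ E_1 ∘ Conj_{U_1})(ρ)] = Σ_{j∈J} b_j · Tr[O · (Conj_{Q_L} ∘ E_L ∘ Conj_{V_{L,j}} ∘ ⋯ ∘ Conj_{Q_1} ∘ E_1 ∘ Conj_{V_{1,j}})(ρ)], where Conj_A(σ) = AσA†. Then the same coefficients satisfy the noiseless relation Tr[O · (Conj_{U_L} ∘ ⋯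 ∘ Conj_{U_1})(ρ)] = Σ_{j∈J} b_j · Tr[O · (Conj_{V_{L,j}} ∘ ⋯ ∘ Conj_{V_{1,j}})(ρ)]. -/
open Matrix

/-- Matrices on `n` qubits, indexed by bit strings. -/
abbrev NMat (n : ℕ) := Matrix (Fin n → Fin 2) (Fin n → Fin 2) ℂ

/-- The four one-qubit matrices `σ₀ = I, σ₁ = X, σ₂ = Y, σ₃ = Z`. -/
noncomputable def pauliMat : Fin 4 → Matrix (Fin 2) (Fin 2) ℂ :=
  ![1, !![0, 1; 1, 0], !![0, -Complex.I; Complex.I, 0], !![1, 0; 0, -1]]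

/-- The `n`-qubit Pauli word `σ_{f(1)} ⊗ ⋯ ⊗ σ_{f(n)}`, realized as a matrix
indexed by bit strings. -/
noncomputable def pauliWord (n : ℕ) (f : Fin n → Fin 4) : NMat n :=
  Matrix.of fun x y => ∏ i, pauliMat (f i) (x i) (y i)

/-- A Pauli channel: a real linear combination of conjugations by Pauli
words. -/
def IsPauliChannel (n : ℕ) (E : NMat n →ₗ[ℂ] NMat n) : Prop :=
  ∃ (m : ℕ) (c : Fin m → ℝ) (g : Fin m → Fin n → Fin 4),
    ∀ σ : NMat n,
      E σ = ∑ r : Fin m, (c r : ℂ) • (pauliWord n (g r) * σ * pauliWord n (g r))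

/-- Conjugation map `Conj_A(σ) = A σ A†`. -/
noncomputable def matConj {n : ℕ} (A σ : NMat n) : NMat n := A * σ * Aᴴ

/-- Sequential application of `L` layer maps, layer `0` applied first. -/
def applyChain {M : Type*} : (L : ℕ) → (Fin L → M → M) → M → M
  | 0, _, ρ => ρ
  | L + 1, step, ρ => step (Fin.last L) (applyChain L (fun l => step l.castSucc) ρ)

theorem isHermitian_pauliMat (a : Fin 4) : (pauliMat a).IsHermitian := by
  fin_cases a <;> ext x y <;> fin_cases x <;> fin_cases y <;> simp [pauliMat]

theorem isHermitian_pauliWord (n : ℕ) (f : Fin n → Fin 4) : (pauliWord n f).IsHermitian := by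
  ext x y
  simp only [pauliWord, conjTranspose_apply, of_apply, star_prod]
  exact Finset.prod_congr rfl fun i _ => (isHermitian_pauliMat (f i)).apply _ _

/-- The conjugation map `matConj A` as a linear map. -/
noncomputable def matConjLinear {n : ℕ} (A : NMat n) : NMat n →ₗ[ℂ] NMat n :=
  LinearMap.mulRight ℂ Aᴴ ∘ₗ LinearMap.mulLeft ℂ A

theorem matConjLinear_apply {n : ℕ} (A σ : NMat n) : matConjLinear A σ = matConj A σ := rfl

/-- A chain of layers, each a linear combination of linear maps, expands multilinearly. -/
theorem applyChain_sum_smul {R M : Type*} [CommSemiring R] [AddCommMonoid M] [Module R M]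
    (L : ℕ) {ι : Fin L → Type*} [∀ l, Fintype (ι l)] (c : ∀ l, ι l → R)
    (T : ∀ l, ι l → M →ₗ[R] M) (x : M) :
    applyChain L (fun l τ => ∑ r, c l r • T l r τ) x =
      ∑ q : ∀ l, ι l, (∏ l, c l (q l)) • applyChain L (fun l => T l (q l)) x := by
  induction L with
  | zero => simp [applyChain]
  | succ L ih =>
    rw [← (Fin.snocEquiv ι).sum_comp, Fintype.sum_prod_type]
    simp only [applyChain, ih, map_sum, map_smul, Finset.smul_sum, Fin.prod_univ_castSucc,
      Fin.snocEquiv_apply, Fin.snoc_castSucc, Fin.snoc_last, smul_smul, mul_comm]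

/-- Inverting every Pauli channel of a noisy chain is a linear combination, with coefficients
independent of the gates, of noisy chains with Pauli insertions. -/
theorem exists_applyChain_eq_sum_pauliWord {n L : ℕ} (E : Fin L → (NMat n →ₗ[ℂ] NMat n))
    (hE : ∀ l, ∃ F : NMat n →ₗ[ℂ] NMat n, IsPauliChannel n F ∧ ∀ σ, F (E l σ) = σ) :
    ∃ (m : Fin L → ℕ) (a : (∀ l, Fin (m l)) → ℂ)
      (Q : (∀ l, Fin (m l)) → Fin L → Fin n → Fin 4),
      ∀ (U : Fin L → NMat n) (ρ : NMat n),
        applyChain L (fun l τ => matConj (U l) τ) ρ =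
          ∑ q, a q • applyChain L
            (fun l τ => matConj (pauliWord n (Q q l)) (E l (matConj (U l) τ))) ρ := by
  choose F hF hFE using hE
  choose m c g hg using hF
  refine ⟨m, fun q => ∏ l, (c l (q l) : ℂ), fun q l => g l (q l), fun U ρ => ?_⟩
  have key := applyChain_sum_smul L (fun l r => (c l r : ℂ))
    (fun l r => matConjLinear (pauliWord n (g l r)) ∘ₗ E l ∘ₗ matConjLinear (U l)) ρ
  simp only [LinearMap.coe_comp, Function.comp_def, matConjLinear_apply] at key
  rw [← key]
  congr 1
  funext l τ
  conv_lhs => rw [← hFE l (matConj (U l) τ), hg]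
  simp only [matConj, (isHermitian_pauliWord n _).eq]


/-- Theorem 1 (Effect of Pauli insertions): if real coefficients `b_j` fit the
noisy circuit relation for every pattern of Pauli-word insertions, then the
same coefficients satisfy the noiseless decomposition relation. -/
theorem pauli_insertion_transfer
    (n L : ℕ) (hn : 1 ≤ n) (hL : 1 ≤ L)
    (E : Fin L → (NMat n →ₗ[ℂ] NMat n))
    (hE : ∀ l, IsPauliChannel n (E l))
    (hEbij : ∀ l, Function.Bijective (E l))
    (hEinv : ∀ l, ∃ F : NMat n →ₗ[ℂ] NMat n,
      IsPauliChannel n F ∧ (∀ σ, F (E l σ) = σ) ∧ (∀ σ, E l (F σ) = σ))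
    (U : Fin L → NMat n)
    (hU : ∀ l, U l ∈ Matrix.unitaryGroup (Fin n → Fin 2) ℂ)
    (J : Type) (sJ : Finset J) (V : J → Fin L → NMat n)
    (hV : ∀ j l, V j l ∈ Matrix.unitaryGroup (Fin n → Fin 2) ℂ)
    (b : J → ℝ) (O ρ : NMat n)
    (hnoisy : ∀ Q : Fin L → Fin n → Fin 4,
      (O * applyChain L
          (fun l τ => matConj (pauliWord n (Q l)) (E l (matConj (U l) τ))) ρ).trace =
        ∑ j ∈ sJ, (b j : ℂ) *
          (O * applyChain L
            (fun l τ => matConj (pauliWord n (Q l)) (E l (matConj (V j l) τ))) ρ).trace) :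
    (O * applyChain L (fun l τ => matConj (U l) τ) ρ).trace =
      ∑ j ∈ sJ, (b j : ℂ) *
        (O * applyChain L (fun l τ => matConj (V j l) τ) ρ).trace := by
  obtain ⟨m, a, Q, h⟩ := exists_applyChain_eq_sum_pauliWord E fun l =>
    (hEinv l).imp fun _ hF => ⟨hF.1, hF.2.1⟩
  simp only [h, Finset.mul_sum, trace_sum, mul_smul_comm, trace_smul, hnoisy, Finset.smul_sum]
  rw [Finset.sum_comm]
end

section
/- (Observation 3, counterexample.) Let θ, φ ∈ ℝ with sin θ · sin φ ≠ 0, and let γ₁ ∈ ℝ, γ₂ ∈ (0, 1/2]. Set a = (1−2γ₂)·sin θ·sin φ + cos θ. Then: (i) the noisy observable relation holds with the single coefficient a on the single Clifford circuit with angles (0,0): Tr[(X+Z)·Ñ(θ,φ)] = a · Tr[(X+Z)·Ñ(0,0)]; but (ii) the corresponding noiseless relation fails: Tr[(X+Z)·N(θ,φ)] ≠ a · Tr[(X+Z)·N(0,0)]. Hence coefficients that exactly fit noisy data need not reproduce the noiseless expectation value. -/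
open Matrix

/-- The Pauli X matrix. -/
noncomputable def Xg : Matrix (Fin 2) (Fin 2) ℂ := !![0, 1; 1, 0]

/-- The Pauli Z matrix. -/
noncomputable def Zg : Matrix (Fin 2) (Fin 2) ℂ := !![1, 0; 0, -1]

/-- The Z-rotation `R_Z(β) = diag(e^{−iβ/2}, e^{iβ/2})`. -/
noncomputable def RZg (β : ℝ) : Matrix (Fin 2) (Fin 2) ℂ :=
  !![Complex.exp (-(Complex.I * (β : ℂ)) / 2), 0;
     0, Complex.exp (Complex.I * (β : ℂ) / 2)]

/-- The X-rotation `R_X(α) = cos(α/2)·I − i·sin(α/2)·X`. -/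
noncomputable def RXg (α : ℝ) : Matrix (Fin 2) (Fin 2) ℂ :=
  (Real.cos (α / 2) : ℂ) • (1 : Matrix (Fin 2) (Fin 2) ℂ) -
    (Complex.I * (Real.sin (α / 2) : ℂ)) • Xg

/-- The state `|0⟩⟨0|`. -/
noncomputable def rho0 : Matrix (Fin 2) (Fin 2) ℂ := !![1, 0; 0, 0]

/-- The Pauli noise channel `E_X(σ) = (1−γ)σ + γ·XσX`. -/
noncomputable def EXc (γ : ℝ) (σ : Matrix (Fin 2) (Fin 2) ℂ) :
    Matrix (Fin 2) (Fin 2) ℂ :=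
  ((1 - γ : ℝ) : ℂ) • σ + (γ : ℂ) • (Xg * σ * Xg)

/-- The Pauli noise channel `E_Z(σ) = (1−γ)σ + γ·ZσZ`. -/
noncomputable def EZc (γ : ℝ) (σ : Matrix (Fin 2) (Fin 2) ℂ) :
    Matrix (Fin 2) (Fin 2) ℂ :=
  ((1 - γ : ℝ) : ℂ) • σ + (γ : ℂ) • (Zg * σ * Zg)

/-- Noiseless circuit output `N(α,β) = R_Z(β) R_X(α) ρ₀ R_X(α)† R_Z(β)†`. -/
noncomputable def noiselessOut (α β : ℝ) : Matrix (Fin 2) (Fin 2) ℂ :=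
  RZg β * (RXg α * rho0 * (RXg α)ᴴ) * (RZg β)ᴴ

/-- Noisy circuit output
`Ñ(α,β) = E_Z(R_Z(β)·E_X(R_X(α) ρ₀ R_X(α)†)·R_Z(β)†)`. -/
noncomputable def noisyOut (γ₁ γ₂ α β : ℝ) : Matrix (Fin 2) (Fin 2) ℂ :=
  EZc γ₂ (RZg β * EXc γ₁ (RXg α * rho0 * (RXg α)ᴴ) * (RZg β)ᴴ)

/-- Pauli-inserted noisy circuit output
`Ñᴾ(α,β) = E_Z(Z·R_Z(β)·E_X(X·R_X(α) ρ₀ R_X(α)†·X)·R_Z(β)†·Z)`. -/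
noncomputable def noisyOutP (γ₁ γ₂ α β : ℝ) : Matrix (Fin 2) (Fin 2) ℂ :=
  EZc γ₂ (Zg * RZg β * EXc γ₁ (Xg * (RXg α * rho0 * (RXg α)ᴴ) * Xg) * (RZg β)ᴴ * Zg)

lemma RZg_eq_half_angle (β : ℝ) :
    RZg β = !![(Real.cos (β / 2) : ℂ) - Real.sin (β / 2) * Complex.I, 0;
      0, (Real.cos (β / 2) : ℂ) + Real.sin (β / 2) * Complex.I] := by
  have hneg : -(Complex.I * (β : ℂ)) / 2 = (-(β / 2 : ℂ)) * Complex.I := by ring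
  have hpos : Complex.I * (β : ℂ) / 2 = (β / 2 : ℂ) * Complex.I := by ring
  rw [RZg, hneg, hpos, Complex.exp_mul_I, Complex.exp_mul_I, Complex.cos_neg, Complex.sin_neg]
  push_cast
  simp only [neg_mul, sub_eq_add_neg]

lemma RXg_eq_half_angle (α : ℝ) :
    RXg α = !![(Real.cos (α / 2) : ℂ), -(Complex.I * Real.sin (α / 2));
      -(Complex.I * Real.sin (α / 2)), (Real.cos (α / 2) : ℂ)] := by
  ext i j
  fin_cases i <;> fin_cases j <;> simp [RXg, Xg]

lemma Matrix.conjTranspose_fin_two_of {R : Type*} [Star R] (a b c d : R) :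
    !![a, b; c, d]ᴴ = !![star a, star c; star b, star d] := by
  ext i j
  fin_cases i <;> fin_cases j <;> rfl

lemma noiselessOut_eq_noisyOut (α β : ℝ) : noiselessOut α β = noisyOut 0 0 α β := by
  simp [noiselessOut, noisyOut, EXc, EZc]

lemma trace_noisyOut (γ₁ γ₂ α β : ℝ) :
    ((Xg + Zg) * noisyOut γ₁ γ₂ α β).trace =
      (((1 - 2 * γ₁) * ((1 - 2 * γ₂) * Real.sin α * Real.sin β + Real.cos α) : ℝ) : ℂ) := by
  have hα : α = 2 * (α / 2) := by ring
  have hβ : β = 2 * (β / 2) := by ring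
  have hsα : Real.sin α = 2 * Real.sin (α / 2) * Real.cos (α / 2) := by
    rw [← Real.sin_two_mul, ← hα]
  have hcα : Real.cos α = Real.cos (α / 2) ^ 2 - Real.sin (α / 2) ^ 2 := by
    rw [← Real.cos_two_mul', ← hα]
  have hsβ : Real.sin β = 2 * Real.sin (β / 2) * Real.cos (β / 2) := by
    rw [← Real.sin_two_mul, ← hβ]
  have hunit := Real.sin_sq_add_cos_sq (β / 2)
  rw [hsα, hcα, hsβ, noisyOut, RZg_eq_half_angle, RXg_eq_half_angle]
  generalize Real.sin (α / 2) = s, Real.cos (α / 2) = c,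
    Real.sin (β / 2) = t, Real.cos (β / 2) = d at *
  have hunit' : (t : ℂ) ^ 2 + (d : ℂ) ^ 2 = 1 := by exact_mod_cast hunit
  simp only [EXc, EZc, Xg, Zg, rho0, Matrix.conjTranspose_fin_two_of, Matrix.mul_fin_two,
    Matrix.smul_of, Matrix.smul_cons, Matrix.smul_empty, Matrix.of_add_of, Matrix.cons_add_cons,
    Matrix.empty_add_empty, Matrix.trace_fin_two_of, smul_eq_mul, star_sub, star_add, star_neg,
    star_mul', Complex.star_def, Complex.conj_ofReal, Complex.conj_I,
    map_zero]
  push_cast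
  linear_combination (1 - 2 * (γ₁ : ℂ)) * (c ^ 2 - s ^ 2) * hunit' +
    (1 - 2 * (γ₁ : ℂ)) * (d ^ 2 * s ^ 2 - t ^ 2 * c ^ 2 - t ^ 2 * s ^ 2 * (Complex.I ^ 2 - 1) -
      4 * (1 - 2 * γ₂) * d * t * c * s) * Complex.I_sq

/-- Observation 3 (counterexample): a single coefficient that exactly fits the
noisy data need not reproduce the noiseless expectation value. -/
theorem noisy_fit_need_not_transfer
    (θ φ γ₁ γ₂ : ℝ) (hs : Real.sin θ * Real.sin φ ≠ 0)
    (hγ₂ : γ₂ ∈ Set.Ioc (0 : ℝ) (1 / 2)) :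
    (((Xg + Zg) * noisyOut γ₁ γ₂ θ φ).trace =
      (((1 - 2 * γ₂) * Real.sin θ * Real.sin φ + Real.cos θ : ℝ) : ℂ) *
        ((Xg + Zg) * noisyOut γ₁ γ₂ 0 0).trace) ∧
    (((Xg + Zg) * noiselessOut θ φ).trace ≠
      (((1 - 2 * γ₂) * Real.sin θ * Real.sin φ + Real.cos θ : ℝ) : ℂ) *
        ((Xg + Zg) * noiselessOut 0 0).trace) := by
  simp only [noiselessOut_eq_noisyOut, trace_noisyOut]
  refine ⟨?_, fun h => ?_⟩
  · simp only [Real.sin_zero, Real.cos_zero]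
    push_cast
    ring
  · have h' := Complex.ofReal_injective (h.trans (Complex.ofReal_mul _ _).symm)
    simp only [Real.sin_zero, Real.cos_zero] at h'
    exact mul_ne_zero hγ₂.1.ne' hs (by linear_combination h' / 2)
end

section
/- (Observation 3, noisy expectation formulas.) For all θ, φ, γ₁, γ₂ ∈ ℝ: Tr[(X+Z)·Ñ(θ,φ)] = (1−2γ₁)(1−2γ₂)·sin θ·sin φ + (1−2γ₁)·cos θ, and Tr[(X+Z)·Ñᴾ(θ,φ)] = (1−2γ₁)(1−2γ₂)·sin θ·sin φ − (1−2γ₁)·cos θ. -/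
open Matrix

theorem RXg_conj_rho0 (α : ℝ) :
    RXg α * rho0 * (RXg α)ᴴ =
      !![(1 + (Real.cos α : ℂ)) / 2, Complex.I * (Real.sin α : ℂ) / 2;
         -(Complex.I * (Real.sin α : ℂ)) / 2, (1 - (Real.cos α : ℂ)) / 2] := by
  have hc : (Real.cos α : ℂ) = 2 * (Real.cos (α / 2) : ℂ) ^ 2 - 1 := by
    rw [← mul_div_cancel₀ α (two_ne_zero), mul_div_assoc, Real.cos_two_mul]
    push_cast
    ring_nf
  have hs : (Real.sin α : ℂ) = 2 * (Real.sin (α / 2) : ℂ) * (Real.cos (α / 2) : ℂ) := by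
    have h := Real.sin_two_mul (α / 2)
    rw [mul_div_cancel₀ α two_ne_zero] at h
    exact_mod_cast h
  have hp : (Real.sin (α / 2) : ℂ) ^ 2 + (Real.cos (α / 2) : ℂ) ^ 2 = 1 := by
    exact_mod_cast Real.sin_sq_add_cos_sq (α / 2)
  rw [hc, hs]
  generalize hx : Real.cos (α / 2) = x at *
  generalize hy : Real.sin (α / 2) = y at *
  ext i j
  fin_cases i <;> fin_cases j <;>
    simp [RXg, Xg, rho0, Matrix.mul_apply, Fin.sum_univ_two, hx, hy,
      -Complex.ofReal_cos, -Complex.ofReal_sin]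
  · ring
  · ring
  · ring
  · linear_combination hp - (y : ℂ) ^ 2 * Complex.I_sq

theorem RZg_conj (β : ℝ) (a b c d : ℂ) :
    RZg β * !![a, b; c, d] * (RZg β)ᴴ =
      !![a, b * ((Real.cos β : ℂ) - Complex.I * (Real.sin β : ℂ));
         c * ((Real.cos β : ℂ) + Complex.I * (Real.sin β : ℂ)), d] := by
  have hplus : Complex.exp (Complex.I * β / 2) * Complex.exp (Complex.I * β / 2) =
      (Real.cos β : ℂ) + Complex.I * (Real.sin β : ℂ) := by
    rw [← Complex.exp_add, add_halves, mul_comm, Complex.exp_mul_I]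
    push_cast
    ring
  have hminus : Complex.exp (-(Complex.I * β) / 2) * Complex.exp (-(Complex.I * β) / 2) =
      (Real.cos β : ℂ) - Complex.I * (Real.sin β : ℂ) := by
    rw [← Complex.exp_add, add_halves, mul_comm, ← neg_mul, Complex.exp_mul_I]
    push_cast
    rw [Complex.cos_neg, Complex.sin_neg]
    ring
  have hone : Complex.exp (-(Complex.I * β) / 2) * Complex.exp (Complex.I * β / 2) = 1 := by
    rw [← Complex.exp_add, ← add_div, neg_add_cancel, zero_div, Complex.exp_zero]
  have hconj : star (Complex.exp (-(Complex.I * β) / 2)) = Complex.exp (Complex.I * β / 2) := by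
    simp [← Complex.exp_conj, Complex.conj_ofNat]
  have hconj' : star (Complex.exp (Complex.I * β / 2)) = Complex.exp (-(Complex.I * β) / 2) := by
    rw [← hconj, star_star]
  have hadj : (RZg β)ᴴ =
      !![Complex.exp (Complex.I * β / 2), 0; 0, Complex.exp (-(Complex.I * β) / 2)] := by
    ext i j
    fin_cases i <;> fin_cases j <;> simp [RZg, hconj, hconj', -RCLike.star_def]
  rw [hadj, ← hplus, ← hminus, RZg]
  generalize Complex.exp (Complex.I * β / 2) = u at *
  generalize Complex.exp (-(Complex.I * β) / 2) = v at *
  ext i j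
  fin_cases i <;> fin_cases j <;> simp [Matrix.mul_apply, Fin.sum_univ_two]
  · linear_combination a * hone
  · ring
  · ring
  · linear_combination d * hone

theorem Xg_conj (a b c d : ℂ) : Xg * !![a, b; c, d] * Xg = !![d, c; b, a] := by
  simp [Xg]

theorem Zg_conj (a b c d : ℂ) : Zg * !![a, b; c, d] * Zg = !![a, -b; -c, d] := by
  simp [Zg]

theorem trace_Xg_add_Zg_mul (a b c d : ℂ) :
    ((Xg + Zg) * !![a, b; c, d]).trace = b + c + a - d := by
  simp [Xg, Zg, Matrix.trace_fin_two]
  ring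

theorem EXc_of (γ : ℝ) (a b c d : ℂ) :
    EXc γ !![a, b; c, d] =
      !![(1 - γ) * a + γ * d, (1 - γ) * b + γ * c;
         (1 - γ) * c + γ * b, (1 - γ) * d + γ * a] := by
  simp [EXc, Xg_conj]

theorem EZc_of (γ : ℝ) (a b c d : ℂ) :
    EZc γ !![a, b; c, d] = !![a, (1 - 2 * γ) * b; (1 - 2 * γ) * c, d] := by
  rw [EZc, Zg_conj]
  ext i j
  fin_cases i <;> fin_cases j <;> simp <;> ring

/-- Observation 3 (noisy expectation formulas). -/
theorem noisy_expectation_formulas (θ φ γ₁ γ₂ : ℝ) :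
    (((Xg + Zg) * noisyOut γ₁ γ₂ θ φ).trace =
      (((1 - 2 * γ₁) * (1 - 2 * γ₂) * Real.sin θ * Real.sin φ +
        (1 - 2 * γ₁) * Real.cos θ : ℝ) : ℂ)) ∧
    (((Xg + Zg) * noisyOutP γ₁ γ₂ θ φ).trace =
      (((1 - 2 * γ₁) * (1 - 2 * γ₂) * Real.sin θ * Real.sin φ -
        (1 - 2 * γ₁) * Real.cos θ : ℝ) : ℂ)) := by
  constructor
  · rw [noisyOut, RXg_conj_rho0, EXc_of, RZg_conj, EZc_of, trace_Xg_add_Zg_mul]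
    push_cast
    linear_combination (-(1 - 2 * γ₁ : ℂ) * (1 - 2 * γ₂) * Complex.sin θ * Complex.sin φ) *
      Complex.I_sq
  · have hassoc (M : Matrix (Fin 2) (Fin 2) ℂ) :
        Zg * RZg φ * M * (RZg φ)ᴴ * Zg = Zg * (RZg φ * M * (RZg φ)ᴴ) * Zg := by
      simp only [Matrix.mul_assoc]
    rw [noisyOutP, hassoc, RXg_conj_rho0, Xg_conj, EXc_of, RZg_conj, Zg_conj, EZc_of,
      trace_Xg_add_Zg_mul]
    push_cast
    linear_combination (-(1 - 2 * γ₁ : ℂ) * (1 - 2 * γ₂) * Complex.sin θ * Complex.sin φ) *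
      Complex.I_sq
end
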